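/- For every natural number n ≥ 39, every admissible multiplicity function m, and every minimal sum labeling ℓ of G(n,m): ℓ(v) < ℓ(w) for every vertex v ∈ ψ(2) and every vertex w ∈ ψ(3). -/

import Mathlib

/-- `Sn n = {2,3,…,n} ∪ {n+2}`. -/
def Sn (n : ℕ) : Set ℕ := {k | (2 ≤ k ∧ k ≤ n) ∨ k = n + 2}

/-- `m` is an admissible multiplicity function for `Sn n`. -/
def Admissible (n : ℕ) (m : ℕ → ℕ) : Prop :=
  (∀ i ∈ Sn n, 2 * i ∈ Sn n → 2 ≤ m i) ∧
  (∀ i ∈ Sn n, 2 * i ∉ Sn n → m i = 1) ∧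
  (∀ i, i ∉ Sn n → m i = 0)

/-- The vertex set of `G(n,m)`: pairs `(i,j)` with `i ∈ Sn n` and `j < m i`. -/
def Vnm (n : ℕ) (m : ℕ → ℕ) : Set (ℕ × ℕ) := {p | p.1 ∈ Sn n ∧ p.2 < m p.1}

/-- Distinct vertices `u`, `v` of `G(n,m)` are adjacent iff `u.1 + v.1 ∈ Sn n`. -/
def AdjG (n : ℕ) (u v : ℕ × ℕ) : Prop := u ≠ v ∧ u.1 + v.1 ∈ Sn n

/-- `psi m i` is the set of vertices induced by the integer `i`. -/
def psi (m : ℕ → ℕ) (i : ℕ) : Set (ℕ × ℕ) := {p | p.1 = i ∧ p.2 < m i}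

/-- The set of proper terminals of a vertex `v` of `G(n,m)`. -/
def tau (n : ℕ) (m : ℕ → ℕ) (v : ℕ × ℕ) : Set (ℕ × ℕ) :=
  {w ∈ Vnm n m | w ≠ v ∧ v.1 + w.1 ∉ Sn n}

/-- A (possibly non-injective) sum labeling of the graph `G(n,m)`. -/
def IsSumLabelingG (n : ℕ) (m : ℕ → ℕ) (ℓ : ℕ × ℕ → ℕ) : Prop :=
  (∀ v ∈ Vnm n m, 1 ≤ ℓ v) ∧
  ∀ u ∈ Vnm n m, ∀ v ∈ Vnm n m, u ≠ v →
    (AdjG n u v ↔ ∃ w ∈ Vnm n m, ℓ u + ℓ v = ℓ w)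

/-- The set of labels used by `ℓ` on the vertices of `G(n,m)`. -/
def labelSet (n : ℕ) (m : ℕ → ℕ) (ℓ : ℕ × ℕ → ℕ) : Set ℕ := {x | ∃ y ∈ Vnm n m, ℓ y = x}

lemma mem_Sn {n k : ℕ} : k ∈ Sn n ↔ (2 ≤ k ∧ k ≤ n) ∨ k = n + 2 := Iff.rfl

lemma Admissible.pos {n : ℕ} {m : ℕ → ℕ} (hm : Admissible n m) {i : ℕ} (hi : i ∈ Sn n) :
    0 < m i := by
  by_cases h : 2 * i ∈ Sn n
  · have := hm.1 i hi h
    omega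
  · have := hm.2.1 i hi h
    omega

lemma Admissible.zero_mem {n : ℕ} {m : ℕ → ℕ} (hm : Admissible n m) {i : ℕ} (hi : i ∈ Sn n) :
    (i, 0) ∈ Vnm n m := ⟨hi, hm.pos hi⟩

/-- A class `i` with `2 * i > n + 2` consists of a single vertex. -/
lemma Admissible.eq_zero {n : ℕ} {m : ℕ → ℕ} (hm : Admissible n m) {y : ℕ × ℕ}
    (hy : y ∈ Vnm n m) {i : ℕ} (hyi : y.1 = i) (hi : n + 2 < 2 * i) : y = (i, 0) := by
  obtain ⟨h1, h2⟩ := hy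
  have := hm.2.1 y.1 h1 (by rw [mem_Sn]; omega)
  ext
  · exact hyi
  · simp only
    omega

lemma Admissible.exists_ne {n : ℕ} {m : ℕ → ℕ} (hm : Admissible n m) {k : ℕ} (hk : k ∈ Sn n)
    (y : ℕ × ℕ) (hy : y.1 = k → 2 * k ∈ Sn n) : ∃ z ∈ Vnm n m, z.1 = k ∧ z ≠ y := by
  by_cases h : y = (k, 0)
  · have := hm.1 k hk (hy (by rw [h]))
    refine ⟨(k, 1), ⟨hk, this⟩, rfl, ?_⟩
    simp [h]
  · exact ⟨(k, 0), hm.zero_mem hk, rfl, fun h' => h h'.symm⟩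

lemma Vnm_finite (n : ℕ) (m : ℕ → ℕ) : (Vnm n m).Finite := by
  refine Set.Finite.subset (Set.Finite.biUnion (Set.finite_Iic (n + 2))
    (fun i _ => (Set.finite_Iio (m i)).image (fun j => (i, j)))) ?_
  rintro ⟨i, j⟩ ⟨h1, h2⟩
  rw [mem_Sn] at h1
  simp only [Set.mem_iUnion, Set.mem_image]
  exact ⟨i, by simp at h1 ⊢; omega, j, h2, rfl⟩

section Labeling

variable {n : ℕ} {m : ℕ → ℕ} {ℓ : ℕ × ℕ → ℕ}

lemma IsSumLabelingG.add_mem_iff (hℓ : IsSumLabelingG n m ℓ) {y z : ℕ × ℕ}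
    (hy : y ∈ Vnm n m) (hz : z ∈ Vnm n m) (hne : y ≠ z) :
    ℓ y + ℓ z ∈ labelSet n m ℓ ↔ y.1 + z.1 ∈ Sn n := by
  have h := hℓ.2 y hy z hz hne
  constructor
  · rintro ⟨w, hw, e⟩
    exact (h.2 ⟨w, hw, e.symm⟩).2
  · intro hs
    obtain ⟨w, hw, e⟩ := h.1 ⟨hne, hs⟩
    exact ⟨w, hw, e.symm⟩

/-- Vertices of different classes with a distinguishing class `k` have different labels. -/
lemma IsSumLabelingG.ne_of_distinguishing (hm : Admissible n m) (hℓ : IsSumLabelingG n m ℓ)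
    {y z : ℕ × ℕ} (hy : y ∈ Vnm n m) (hz : z ∈ Vnm n m) {k : ℕ} (hk : k ∈ Sn n)
    (hky : y.1 + k ∈ Sn n) (hkz : z.1 + k ∉ Sn n) (hne : z.1 ≠ k) : ℓ y ≠ ℓ z := by
  intro h
  obtain ⟨x, hx, rfl, hxy⟩ := hm.exists_ne hk y (by rintro rfl; rwa [two_mul])
  have h1 := (hℓ.add_mem_iff hy hx hxy.symm).2 hky
  rw [h, hℓ.add_mem_iff hz hx (fun e => hne (by rw [e]))] at h1
  exact hkz h1

lemma IsSumLabelingG.ne_of_lt (hn : 39 ≤ n) (hm : Admissible n m) (hℓ : IsSumLabelingG n m ℓ)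
    {y z : ℕ × ℕ} (hy : y ∈ Vnm n m) (hz : z ∈ Vnm n m) (hlt : y.1 < z.1) : ℓ y ≠ ℓ z := by
  have hy1 := hy.1
  have hz1 := hz.1
  rw [mem_Sn] at hy1 hz1
  by_cases h1 : y.1 + z.1 = n + 2
  · by_cases h2 : z.1 = y.1 + 2
    · refine hℓ.ne_of_distinguishing hm hy hz (k := n - y.1 - 1) ?_ ?_ ?_ ?_ <;>
        first | rw [mem_Sn]; omega | omega
    · refine hℓ.ne_of_distinguishing hm hy hz (k := n - y.1) ?_ ?_ ?_ ?_ <;>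
        first | rw [mem_Sn]; omega | omega
  · refine hℓ.ne_of_distinguishing hm hy hz (k := n + 2 - y.1) ?_ ?_ ?_ ?_ <;>
      first | rw [mem_Sn]; omega | omega

lemma IsSumLabelingG.ne_of_ne (hn : 39 ≤ n) (hm : Admissible n m) (hℓ : IsSumLabelingG n m ℓ)
    {y z : ℕ × ℕ} (hy : y ∈ Vnm n m) (hz : z ∈ Vnm n m) (hne : y.1 ≠ z.1) : ℓ y ≠ ℓ z := by
  rcases lt_or_gt_of_ne hne with h | h
  · exact hℓ.ne_of_lt hn hm hy hz h
  · exact (hℓ.ne_of_lt hn hm hz hy h).symm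

/-- The isolated vertex carries the largest label. -/
lemma IsSumLabelingG.le_isolated (hm : Admissible n m) (hℓ : IsSumLabelingG n m ℓ) {x : ℕ}
    (hx : x ∈ labelSet n m ℓ) : x ≤ ℓ (n + 2, 0) := by
  obtain ⟨y₀, hy₀, rfl⟩ := hx
  obtain ⟨y, hy, hmax⟩ := (Vnm_finite n m).exists_maximalFor ℓ _ ⟨y₀, hy₀⟩
  have hle : ∀ z ∈ Vnm n m, ℓ z ≤ ℓ y := fun z hz => by
    rcases le_total (ℓ z) (ℓ y) with h | h
    · exact h
    · exact hmax hz h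
  have hy1 := hy.1
  rw [mem_Sn] at hy1
  by_cases h : y.1 = n + 2
  · rw [← hm.eq_zero hy h (by omega)]
    exact hle _ hy₀
  · obtain ⟨z, hz, hz1, hzy⟩ := hm.exists_ne (k := n + 2 - y.1) (by rw [mem_Sn]; omega) y
      (fun e => by rw [mem_Sn]; omega)
    obtain ⟨w, hw, e⟩ := (hℓ.add_mem_iff hy hz hzy.symm).2 (by rw [mem_Sn]; omega)
    have := hle w hw
    have := hℓ.1 z hz
    omega

lemma IsSumLabelingG.injOn (hn : 39 ≤ n) (hm : Admissible n m) (hℓ : IsSumLabelingG n m ℓ) :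
    Set.InjOn (fun i => ℓ (i, 0)) (Finset.Icc 2 n : Finset ℕ) := by
  intro i hi j hj h
  simp only [Finset.coe_Icc, Set.mem_Icc] at hi hj
  by_contra hne
  exact hℓ.ne_of_ne hn hm (hm.zero_mem (Or.inl hi)) (hm.zero_mem (Or.inl hj)) hne h

/-- A finite set containing all labels has at least `38` elements. -/
lemma IsSumLabelingG.card_le (hn : 39 ≤ n) (hm : Admissible n m) (hℓ : IsSumLabelingG n m ℓ)
    {F : Finset ℕ} (hF : ∀ x ∈ labelSet n m ℓ, x ∈ F) : 38 ≤ F.card := by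
  have h : (Finset.Icc 2 n).card ≤ F.card :=
    Finset.card_le_card_of_injOn _ (fun i hi => hF _ ⟨(i, 0), hm.zero_mem
      (Or.inl (by simpa using hi)), rfl⟩) (hℓ.injOn hn hm)
  rw [Nat.card_Icc] at h
  omega

lemma IsSumLabelingG.terminal_two (hn : 39 ≤ n) (hm : Admissible n m)
    (hℓ : IsSumLabelingG n m ℓ) {v : ℕ × ℕ} (hv : v ∈ Vnm n m) (hv2 : v.1 = 2)
    {x : ℕ} (hx : x ∈ labelSet n m ℓ) :
    x = ℓ v ∨ x = ℓ (n - 1, 0) ∨ x = ℓ (n + 2, 0) ∨ x + ℓ v ∈ labelSet n m ℓ := by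
  obtain ⟨y, hy, rfl⟩ := hx
  by_cases hyv : y = v
  · simp [hyv]
  have hy1 := hy.1
  have h := hℓ.add_mem_iff hy hv hyv
  rw [mem_Sn] at hy1 h
  by_cases e1 : y.1 = n - 1
  · simp [hm.eq_zero hy e1 (by omega)]
  by_cases e2 : y.1 = n + 2
  · simp [hm.eq_zero hy e2 (by omega)]
  exact Or.inr (Or.inr (Or.inr (h.2 (by omega))))

lemma IsSumLabelingG.terminal_three (hn : 39 ≤ n) (hm : Admissible n m)
    (hℓ : IsSumLabelingG n m ℓ) {w : ℕ × ℕ} (hw : w ∈ Vnm n m) (hw3 : w.1 = 3)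
    {x : ℕ} (hx : x ∈ labelSet n m ℓ) :
    x = ℓ w ∨ x = ℓ (n, 0) ∨ x = ℓ (n - 2, 0) ∨ x = ℓ (n + 2, 0) ∨
      x + ℓ w ∈ labelSet n m ℓ := by
  obtain ⟨y, hy, rfl⟩ := hx
  by_cases hyw : y = w
  · simp [hyw]
  have hy1 := hy.1
  have h := hℓ.add_mem_iff hy hw hyw
  rw [mem_Sn] at hy1 h
  by_cases e1 : y.1 = n
  · simp [hm.eq_zero hy e1 (by omega)]
  by_cases e2 : y.1 = n - 2
  · simp [hm.eq_zero hy e2 (by omega)]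
  by_cases e3 : y.1 = n + 2
  · simp [hm.eq_zero hy e3 (by omega)]
  exact Or.inr (Or.inr (Or.inr (Or.inr (h.2 (by omega)))))

lemma IsSumLabelingG.terminal_five (hn : 39 ≤ n) (hm : Admissible n m)
    (hℓ : IsSumLabelingG n m ℓ) {w : ℕ × ℕ} (hw : w ∈ Vnm n m) (hw5 : w.1 = 5)
    {x : ℕ} (hx : x ∈ labelSet n m ℓ) :
    x = ℓ w ∨ x = ℓ (n, 0) ∨ x = ℓ (n - 1, 0) ∨ x = ℓ (n - 2, 0) ∨ x = ℓ (n - 4, 0) ∨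
      x = ℓ (n + 2, 0) ∨ x + ℓ w ∈ labelSet n m ℓ := by
  obtain ⟨y, hy, rfl⟩ := hx
  by_cases hyw : y = w
  · simp [hyw]
  have hy1 := hy.1
  have h := hℓ.add_mem_iff hy hw hyw
  rw [mem_Sn] at hy1 h
  by_cases e1 : y.1 = n
  · simp [hm.eq_zero hy e1 (by omega)]
  by_cases e2 : y.1 = n - 1
  · simp [hm.eq_zero hy e2 (by omega)]
  by_cases e3 : y.1 = n - 2
  · simp [hm.eq_zero hy e3 (by omega)]
  by_cases e4 : y.1 = n - 4
  · simp [hm.eq_zero hy e4 (by omega)]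
  by_cases e5 : y.1 = n + 2
  · simp [hm.eq_zero hy e5 (by omega)]
  exact Or.inr (Or.inr (Or.inr (Or.inr (Or.inr (Or.inr (h.2 (by omega)))))))

end Labeling

section Progressions

variable {L : Set ℕ} {a b p q r M : ℕ}

/-- Adding `a` repeatedly, every element of `L` reaches one of the three terminals. -/
lemma exists_terminal (hpos : 0 < a) (hM : ∀ x ∈ L, x ≤ M)
    (hA : ∀ x ∈ L, x = a ∨ x = q ∨ x = M ∨ x + a ∈ L) {y : ℕ} (hy : y ∈ L) :
    ∃ k : ℕ, y + k * a = a ∨ y + k * a = q ∨ y + k * a = M := by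
  induction h : M - y using Nat.strong_induction_on generalizing y with
  | _ N ih =>
    subst h
    rcases hA y hy with h | h | h | h
    · exact ⟨0, by simp [h]⟩
    · exact ⟨0, by simp [h]⟩
    · exact ⟨0, by simp [h]⟩
    · have := hM _ h
      obtain ⟨k, hk⟩ := ih (M - (y + a)) (by omega) h rfl
      refine ⟨k + 1, ?_⟩
      rwa [add_one_mul, add_comm (k * a), ← add_assoc]

lemma mod_eq_terminal (hpos : 0 < a) (hM : ∀ x ∈ L, x ≤ M)
    (hA : ∀ x ∈ L, x = a ∨ x = q ∨ x = M ∨ x + a ∈ L) {y : ℕ} (hy : y ∈ L) :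
    y % a = 0 ∨ y % a = q % a ∨ y % a = M % a := by
  obtain ⟨k, h | h | h⟩ := exists_terminal hpos hM hA hy
  · left
    have := congrArg (· % a) h
    simpa using this
  · right; left
    rw [← h]; simp
  · right; right
    rw [← h]; simp

/-- A set that is too large to be covered by four short progressions contains a progression
of length six. -/
lemma exists_long_progression
    (hcard : ∀ F : Finset ℕ, (∀ x ∈ L, x ∈ F) → 38 ≤ F.card)
    (hB : ∀ x ∈ L, x = b ∨ x = p ∨ x = r ∨ x = M ∨ x + b ∈ L) :
    ∃ x, ∀ k < 6, x + k * b ∈ L := by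
  by_contra! hno
  let T : Finset ℕ := {b, p, r, M}
  have hT : T.card ≤ 4 := Finset.card_le_four
  let F : Finset ℕ := (T ×ˢ Finset.range 5).image (fun t => t.1 - t.2 * b)
  have hF : F.card ≤ 20 := by
    refine Finset.card_image_le.trans ?_
    rw [Finset.card_product, Finset.card_range]
    omega
  have := hcard F (fun x hx => ?_)
  · omega
  by_contra hxF
  have hT' : ∀ k < 5, x + k * b ∉ T := by
    intro k hk ht
    refine hxF (Finset.mem_image.2 ⟨(x + k * b, k), ?_, by simp⟩)
    exact Finset.mem_product.2 ⟨ht, Finset.mem_range.2 hk⟩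
  have hall : ∀ k < 6, x + k * b ∈ L := by
    intro k
    induction k with
    | zero => intro _; simpa using hx
    | succ k ih =>
      intro hk
      have h1 := hT' k (by omega)
      simp only [T, Finset.mem_insert, Finset.mem_singleton, not_or] at h1
      have h2 := hB _ (ih (by omega))
      rw [add_one_mul, ← add_assoc]
      tauto
  obtain ⟨k, hk, hk'⟩ := hno x
  exact hk' (hall k hk)

lemma dvd_of_add_mod_eq {x d : ℕ} (h : x % a = (x + d) % a) : a ∣ d := by
  have h1 : x ≡ x + d [MOD a] := h
  have h2 : x + 0 ≡ x + d [MOD a] := by simpa using h1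
  exact (Nat.modEq_zero_iff_dvd.1 (Nat.ModEq.add_left_cancel' x h2).symm)

/-- Large sets that decompose into few progressions for both differences `b < a` force
`a = 2 * b`. -/
lemma eq_two_mul_of_progressions (hb : 0 < b) (hab : b < a) (hL : ∀ x ∈ L, 0 < x)
    (hM : ∀ x ∈ L, x ≤ M)
    (hA : ∀ x ∈ L, x = a ∨ x = q ∨ x = M ∨ x + a ∈ L)
    {x : ℕ} (hx : ∀ k < 6, x + k * b ∈ L) : a = 2 * b := by
  have ha : 0 < a := by omega
  have hmod := fun {y} hy => mod_eq_terminal (y := y) ha hM hA hy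
  by_contra hne
  have h1 : ¬ a ∣ b := fun h => by have := Nat.le_of_dvd hb h; omega
  have h2 : ¬ a ∣ 2 * b := by
    rintro ⟨c, hc⟩
    rcases c with _ | _ | c
    · omega
    · omega
    · nlinarith
  have hd : ∀ y, (y % a ≠ (y + b) % a) ∧ (y % a ≠ (y + 2 * b) % a) := fun y =>
    ⟨fun h => h1 (dvd_of_add_mod_eq h), fun h => h2 (dvd_of_add_mod_eq h)⟩
  have e1 := hd x
  have e2 := hd (x + b)
  have e3 := hd (x + 2 * b)
  rw [show x + b + b = x + 2 * b by ring, show x + b + 2 * b = x + 3 * b by ring] at e2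
  rw [show x + 2 * b + b = x + 3 * b by ring] at e3
  have m0 := hmod (by simpa using hx 0 (by omega))
  have m1 := hmod (by simpa using hx 1 (by omega))
  have m2 := hmod (hx 2 (by omega))
  have m3 := hmod (hx 3 (by omega))
  have h3 : a ∣ 3 * b := dvd_of_add_mod_eq (x := x) (by omega)
  have hzero : ∃ i < 3, (x + i * b) % a = 0 := by
    by_contra! hno
    have n0 := hno 0 (by omega)
    have n1 := hno 1 (by omega)
    have n2 := hno 2 (by omega)
    simp only [zero_mul, one_mul, add_zero] at n0 n1
    omega
  obtain ⟨i, hi, hi0⟩ := hzero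
  have hz : a ∣ x + i * b := Nat.dvd_of_mod_eq_zero hi0
  have hy0 : a ∣ x + (i + 3) * b := by
    rw [show x + (i + 3) * b = x + i * b + 3 * b by ring]
    exact dvd_add hz h3
  have hlt : a < x + (i + 3) * b := by
    have := Nat.le_of_dvd (hL _ (hx i (by omega))) hz
    rw [show x + (i + 3) * b = x + i * b + 3 * b by ring]
    omega
  have hterm : q % a = 0 ∨ M % a = 0 := by
    obtain ⟨k, h | h | h⟩ := exists_terminal ha hM hA (hx (i + 3) (by omega))
    · nlinarith
    · left
      rw [← h]
      exact Nat.mod_eq_zero_of_dvd (dvd_add hy0 (dvd_mul_left _ _))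
    · right
      rw [← h]
      exact Nat.mod_eq_zero_of_dvd (dvd_add hy0 (dvd_mul_left _ _))
  rcases hterm with h | h <;> rw [h] at m0 m1 m2 <;> omega

/-- If `1 ∈ L` and `L` decomposes into few progressions of differences `b` and `2 * b`,
then `b = 1`. -/
lemma eq_one_of_progressions (hb : 0 < b) (hL : ∀ x ∈ L, 0 < x) (hM : ∀ x ∈ L, x ≤ M)
    (hone : 1 ∈ L) (hbL : b ∈ L) (haL : 2 * b ∈ L) (hqp : q ≠ p) (hqr : q ≠ r) (hqM : q ≠ M)
    (hA : ∀ x ∈ L, x = 2 * b ∨ x = q ∨ x = M ∨ x + 2 * b ∈ L)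
    (hB : ∀ x ∈ L, x = b ∨ x = p ∨ x = r ∨ x = M ∨ x + b ∈ L)
    {x : ℕ} (hx : ∀ k < 6, x + k * b ∈ L) : b = 1 := by
  by_contra hb1
  have hmod := fun {y} hy => mod_eq_terminal (y := y) (a := 2 * b) (by omega) hM hA hy
  have hbm : b % (2 * b) = b := Nat.mod_eq_of_lt (by omega)
  have h1m : 1 % (2 * b) = 1 := Nat.mod_eq_of_lt (by omega)
  have hb1m : (1 + b) % (2 * b) = 1 + b := Nat.mod_eq_of_lt (by omega)
  have r1 := hmod hbL
  have r2 := hmod hone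
  rw [hbm] at r1
  rw [h1m] at r2
  have key : ∀ j, 1 + j * (2 * b) ∈ L → 1 + j * (2 * b) = p ∨ 1 + j * (2 * b) = r ∨
      1 + j * (2 * b) = M := by
    intro j hj
    rcases hB _ hj with h | h | h | h | h
    · have := congrArg (· % (2 * b)) h
      simp only [Nat.add_mul_mod_self_right, hbm, h1m] at this
      omega
    · exact Or.inl h
    · exact Or.inr (Or.inl h)
    · exact Or.inr (Or.inr h)
    · have := hmod h
      rw [show 1 + j * (2 * b) + b = 1 + b + j * (2 * b) by ring,
        Nat.add_mul_mod_self_right, hb1m] at this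
      omega
  have hMle : M ≤ 1 + 2 * (2 * b) := by
    have k0 := key 0 (by simpa using hone)
    have k1 := key 1
    have k2 := key 2
    have a0 := hA 1 hone
    have a1 := hA (1 + 2 * b)
    have := hM _ haL
    rw [show 1 + 2 * b + 2 * b = 1 + 2 * (2 * b) by ring] at a1
    simp only [zero_mul, add_zero, one_mul] at k0 k1
    by_contra hlt
    have c0 : 1 + 2 * b ∈ L := by
      rcases a0 with h | h | h | h
      · omega
      · omega
      · omega
      · exact h
    have d1 := k1 c0
    have c1 : 1 + 2 * (2 * b) ∈ L := by
      rcases a1 c0 with h | h | h | h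
      · omega
      · omega
      · omega
      · exact h
    have d2 := k2 c1
    omega
  have h0 := hL _ (hx 0 (by omega))
  have h5 := hM _ (hx 5 (by omega))
  omega

/-- The shape of a label set in which the classes `2` and `3` carry the labels `2` and `1`. -/
lemma shape_of_progressions (hM : ∀ x ∈ L, x ≤ M) (hM38 : 38 ≤ M)
    (hL : ∀ x ∈ L, 0 < x) (hone : 1 ∈ L) (htwo : 2 ∈ L)
    (hp : p ∈ L) (hr : r ∈ L) (hq : q ∈ L)
    (hne : [1, 2, p, q, r, M].Nodup)
    (hA : ∀ x ∈ L, x = 2 ∨ x = q ∨ x = M ∨ x + 2 ∈ L)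
    (hB : ∀ x ∈ L, x = 1 ∨ x = p ∨ x = r ∨ x = M ∨ x + 1 ∈ L)
    (hp1 : p + 1 ∉ L) (hr1 : r + 1 ∉ L)
    (hp2 : p + 2 ∈ L) (hr2 : r + 2 ∈ L)
    (hpr : p + r ∉ L) (hpq : q + p ∉ L) (hrq : q + r ∉ L) :
    (∀ y, 0 < y → y ≤ M → y ∉ L → y = p + 1 ∨ y = r + 1) ∧
      (p = r + 2 ∧ q + 1 = r ∧ M = r + 4 ∨ r = p + 2 ∧ q + 1 = p ∧ M = p + 4) := by
  have hmem : ∀ y, 0 < y → y ≤ M → y ∉ L → y = p + 1 ∨ y = r + 1 := by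
    intro y
    induction y with
    | zero => omega
    | succ y ih =>
      intro _ hyM hyL
      have hy0 : 0 < y := Nat.pos_of_ne_zero fun h => hyL (by simpa [h] using hone)
      by_cases hy : y ∈ L
      · rcases hB y hy with rfl | h | h | h | h
        · exact absurd htwo hyL
        · omega
        · omega
        · omega
        · exact absurd h hyL
      · rcases ih hy0 (by omega) hy with rfl | rfl
        · exact absurd hp2 hyL
        · exact absurd hr2 hyL
  refine ⟨hmem, ?_⟩
  simp only [List.nodup_cons, List.mem_cons, List.not_mem_nil, not_or] at hne
  have p0 := hL p hp
  have q0 := hL q hq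
  have r0 := hL r hr
  have hbefore : ∀ t, 3 ≤ t → t ≤ M → t + 1 ∉ L →
      t = 3 ∨ t = q + 1 ∨ t = p + 2 ∨ t = r + 2 := by
    intro t ht htM ht1
    by_cases h : t - 1 ∈ L
    · rcases hA _ h with h | h | h | h
      · omega
      · omega
      · omega
      · exact absurd (by rwa [show t - 1 + 2 = t + 1 by omega] at h) ht1
    · have := hmem (t - 1) (by omega) (by omega) h
      omega
  have P := hbefore p (by omega) (hM p hp) hp1
  have R := hbefore r (by omega) (hM r hr) hr1
  have Q := hbefore M (by omega) le_rfl fun h => by have := hM _ h; omega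
  have s1 := hmem (p + r)
  have s2 := hmem (q + p)
  have s3 := hmem (q + r)
  simp only [hpr, hpq, hrq, not_false_eq_true, true_imp_iff] at s1 s2 s3
  have := hM p hp
  have := hM q hq
  have := hM r hr
  have := hM _ hp2
  have := hM _ hr2
  omega

end Progressions

/-- If some label on class `3` does not exceed some label on class `2`, these labels are
`1` and `2`. -/
lemma IsSumLabelingG.eq_one_two_of_le {n : ℕ} {m : ℕ → ℕ} {ℓ : ℕ × ℕ → ℕ} (hn : 39 ≤ n)
    (hm : Admissible n m) (hℓ : IsSumLabelingG n m ℓ) (hone : 1 ∈ labelSet n m ℓ)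
    {v w : ℕ × ℕ} (hv : v ∈ Vnm n m) (hw : w ∈ Vnm n m) (hv2 : v.1 = 2) (hw3 : w.1 = 3)
    (hle : ℓ w ≤ ℓ v) : ℓ w = 1 ∧ ℓ v = 2 := by
  have hlt : ℓ w < ℓ v := lt_of_le_of_ne hle (hℓ.ne_of_ne hn hm hw hv (by omega))
  have hb := hℓ.1 w hw
  have hL : ∀ x ∈ labelSet n m ℓ, 0 < x := by
    rintro _ ⟨y, hy, rfl⟩
    exact hℓ.1 y hy
  have hM : ∀ x ∈ labelSet n m ℓ, x ≤ ℓ (n + 2, 0) := fun _ => hℓ.le_isolated hm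
  have hA := fun x => hℓ.terminal_two hn hm hv hv2 (x := x)
  have hB := fun x => hℓ.terminal_three hn hm hw hw3 (x := x)
  have hq := hm.zero_mem (i := n - 1) (by rw [mem_Sn]; omega)
  have hne : ∀ i ∈ Sn n, n - 1 ≠ i → ℓ (n - 1, 0) ≠ ℓ (i, 0) := fun i hi h =>
    hℓ.ne_of_ne hn hm hq (hm.zero_mem hi) h
  obtain ⟨x, hx⟩ := exists_long_progression (fun F => hℓ.card_le hn hm (F := F)) hB
  have h2 := eq_two_mul_of_progressions hb hlt hL hM hA hx
  rw [h2] at hA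
  have h1 := eq_one_of_progressions hb hL hM hone ⟨w, hw, rfl⟩ ⟨v, hv, h2⟩
    (hne n (by rw [mem_Sn]; omega) (by omega)) (hne (n - 2) (by rw [mem_Sn]; omega) (by omega))
    (hne (n + 2) (by rw [mem_Sn]; omega) (by omega)) hA hB hx
  exact ⟨h1, by omega⟩

/-- For `n ≥ 39`, any admissible `m`, and any minimal sum labeling `ℓ` of
`G(n,m)`, every vertex of `ψ(2)` has a smaller label than every vertex of
`ψ(3)`. -/
theorem psi_two_lt_psi_three (n : ℕ) (hn : 39 ≤ n) (m : ℕ → ℕ)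
    (hm : Admissible n m) (ℓ : ℕ × ℕ → ℕ) (hℓ : IsSumLabelingG n m ℓ)
    (hmin : ∃ u ∈ Vnm n m, ℓ u = 1)
    (v w : ℕ × ℕ) (hv : v ∈ psi m 2) (hw : w ∈ psi m 3) :
    ℓ v < ℓ w := by
  by_contra hlt
  have hvV : v ∈ Vnm n m := ⟨by rw [hv.1, mem_Sn]; omega, by rw [hv.1]; exact hv.2⟩
  have hwV : w ∈ Vnm n m := ⟨by rw [hw.1, mem_Sn]; omega, by rw [hw.1]; exact hw.2⟩
  obtain ⟨hb, ha⟩ := hℓ.eq_one_two_of_le hn hm hmin hvV hwV hv.1 hw.1 (by omega)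
  have hL : ∀ x ∈ labelSet n m ℓ, 0 < x := by
    rintro _ ⟨y, hy, rfl⟩
    exact hℓ.1 y hy
  have hM : ∀ x ∈ labelSet n m ℓ, x ≤ ℓ (n + 2, 0) := fun _ => hℓ.le_isolated hm
  have hM38 : 38 ≤ ℓ (n + 2, 0) := by
    have := hℓ.card_le hn hm (F := Finset.Icc 1 (ℓ (n + 2, 0)))
      (fun x hx => Finset.mem_Icc.2 ⟨hL x hx, hM x hx⟩)
    simpa using this
  have hA := fun x => hℓ.terminal_two hn hm hvV hv.1 (x := x)
  have hB := fun x => hℓ.terminal_three hn hm hwV hw.1 (x := x)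
  have adj2 : ∀ i ∈ Sn n, i ≠ 2 →
      (ℓ (i, 0) + 2 ∈ labelSet n m ℓ ↔ i + 2 ∈ Sn n) := fun i hi h => by
    have := hℓ.add_mem_iff (hm.zero_mem hi) hvV fun e => h (by rw [← hv.1, ← e])
    rwa [ha, hv.1] at this
  have adj3 : ∀ i ∈ Sn n, i ≠ 3 →
      (ℓ (i, 0) + 1 ∈ labelSet n m ℓ ↔ i + 3 ∈ Sn n) := fun i hi h => by
    have := hℓ.add_mem_iff (hm.zero_mem hi) hwV fun e => h (by rw [← hw.1, ← e])
    rwa [hb, hw.1] at this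
  have adj : ∀ i ∈ Sn n, ∀ j ∈ Sn n, i ≠ j →
      (ℓ (i, 0) + ℓ (j, 0) ∈ labelSet n m ℓ ↔ i + j ∈ Sn n) := fun i hi j hj h =>
    hℓ.add_mem_iff (hm.zero_mem hi) (hm.zero_mem hj) (by simpa using h)
  have ne : ∀ i ∈ Sn n, ∀ j ∈ Sn n, i ≠ j → ℓ (i, 0) ≠ ℓ (j, 0) := fun i hi j hj h =>
    hℓ.ne_of_ne hn hm (hm.zero_mem hi) (hm.zero_mem hj) h
  have ne1 : ∀ i ∈ Sn n, i ≠ 3 → ℓ (i, 0) ≠ 1 := fun i hi h => by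
    rw [← hb]
    exact hℓ.ne_of_ne hn hm (hm.zero_mem hi) hwV (by rwa [hw.1])
  have ne2 : ∀ i ∈ Sn n, i ≠ 2 → ℓ (i, 0) ≠ 2 := fun i hi h => by
    rw [← ha]
    exact hℓ.ne_of_ne hn hm (hm.zero_mem hi) hvV (by rwa [hv.1])
  have mem : ∀ i ∈ Sn n, ℓ (i, 0) ∈ labelSet n m ℓ := fun i hi => ⟨_, hm.zero_mem hi, rfl⟩
  have i4 : 4 ∈ Sn n := by rw [mem_Sn]; omega
  have i5 : 5 ∈ Sn n := by rw [mem_Sn]; omega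
  have is : n - 3 ∈ Sn n := by rw [mem_Sn]; omega
  have ir : n - 2 ∈ Sn n := by rw [mem_Sn]; omega
  have iq : n - 1 ∈ Sn n := by rw [mem_Sn]; omega
  have ip : n ∈ Sn n := by rw [mem_Sn]; omega
  have iM : n + 2 ∈ Sn n := by rw [mem_Sn]; omega
  have n1 := ne _ ip _ iq (by omega)
  have n2 := ne _ ip _ ir (by omega)
  have n3 := ne _ ip _ iM (by omega)
  have n4 := ne _ iq _ ir (by omega)
  have n5 := ne _ iq _ iM (by omega)
  have n6 := ne _ ir _ iM (by omega)
  have l1 := ne1 _ ip (by omega)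
  have l2 := ne1 _ iq (by omega)
  have l3 := ne1 _ ir (by omega)
  have t1 := ne2 _ ip (by omega)
  have t2 := ne2 _ iq (by omega)
  have t3 := ne2 _ ir (by omega)
  rw [ha] at hA
  rw [hb] at hB
  obtain ⟨hmem, h⟩ := shape_of_progressions hM hM38 hL hmin ⟨v, hvV, ha⟩
    (mem _ ip) (mem _ ir) (mem _ iq)
    (by
      simp only [List.nodup_cons, List.mem_cons, List.not_mem_nil, not_or, List.nodup_nil,
        not_false_eq_true, and_true]
      omega)
    hA hB
    (by rw [adj3 _ ip (by omega), mem_Sn]; omega)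
    (by rw [adj3 _ ir (by omega), mem_Sn]; omega)
    (by rw [adj2 _ ip (by omega), mem_Sn]; omega)
    (by rw [adj2 _ ir (by omega), mem_Sn]; omega)
    (by rw [adj _ ip _ ir (by omega), mem_Sn]; omega)
    (by rw [adj _ iq _ ip (by omega), mem_Sn]; omega)
    (by rw [adj _ iq _ ir (by omega), mem_Sn]; omega)
  have hgap1 : ℓ (n, 0) + 1 ∉ labelSet n m ℓ := by
    rw [adj3 _ ip (by omega), mem_Sn]; omega
  have hgap2 : ℓ (n - 2, 0) + 1 ∉ labelSet n m ℓ := by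
    rw [adj3 _ ir (by omega), mem_Sn]; omega
  have hmem' : ∀ y ∈ labelSet n m ℓ, y ≠ ℓ (n, 0) + 1 ∧ y ≠ ℓ (n - 2, 0) + 1 := fun y hy =>
    ⟨fun e => hgap1 (e ▸ hy), fun e => hgap2 (e ▸ hy)⟩
  have c1 := ne1 _ i4 (by omega)
  have c2 := ne2 _ i4 (by omega)
  have c0 := hL _ (mem _ i4)
  have d0 := hL _ (mem _ i5)
  have hcr : ℓ (n - 2, 0) + ℓ (4, 0) ∈ labelSet n m ℓ := by
    rw [adj _ ir _ i4 (by omega), mem_Sn]; omega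
  have hcr1 := hM _ hcr
  have hcr2 := hmem' _ hcr
  obtain ⟨hpr, hqr, hMr⟩ | h := h
  swap
  · omega
  have hc : ℓ (4, 0) = 4 := by omega
  have hs : ℓ (n - 3, 0) + 3 = ℓ (n - 2, 0) := by
    have h4 : ℓ (n - 3, 0) + ℓ (4, 0) ∉ labelSet n m ℓ := by
      rw [adj _ is _ i4 (by omega), mem_Sn]; omega
    have := hmem (ℓ (n - 3, 0) + ℓ (4, 0)) (by omega)
    have := fun h => this h h4
    have := hM _ (mem _ is)
    have := hmem' _ (mem _ is)
    have := ne _ is _ iq (by omega)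
    have := ne _ is _ ir (by omega)
    have := ne _ is _ ip (by omega)
    have := ne _ is _ iM (by omega)
    omega
  have hd : ℓ (5, 0) = 7 := by
    have hds : ℓ (n - 3, 0) + ℓ (5, 0) ∈ labelSet n m ℓ := by
      rw [adj _ is _ i5 (by omega), mem_Sn]; omega
    have hdq : ℓ (n - 1, 0) + ℓ (5, 0) ∉ labelSet n m ℓ := by
      rw [adj _ iq _ i5 (by omega), mem_Sn]; omega
    have := hM _ hds
    have := hmem' _ hds
    have := hmem (ℓ (n - 1, 0) + ℓ (5, 0)) (by omega)
    have := fun h => this h hdq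
    have := ne1 _ i5 (by omega)
    have := ne2 _ i5 (by omega)
    have := ne _ i5 _ i4 (by omega)
    omega
  have hlast : ∀ x, x + 2 = ℓ (n - 2, 0) ∨ x + 4 = ℓ (n - 2, 0) → x = ℓ (n - 4, 0) := by
    intro x hx
    have hxL : x ∈ labelSet n m ℓ := by
      by_contra hxL
      have := hmem x (by omega) (by omega) hxL
      omega
    have hx7 : x + 7 ∉ labelSet n m ℓ := fun h => by
      have := hM _ h
      have := hmem' _ h
      omega
    have := hℓ.terminal_five hn hm (hm.zero_mem i5) rfl hxL
    rw [hd] at this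
    simp only [hx7, or_false] at this
    omega
  have e1 := hlast (ℓ (n - 2, 0) - 2) (by omega)
  have e2 := hlast (ℓ (n - 2, 0) - 4) (by omega)
  omega
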